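/- arXiv:2406.06905 — 2 statements merged into one kernel-verified Lean document; each statement's English description precedes it below -/
import Mathlib

section
/- Let d ≥ 5 and α > 4 (so that min(d,α) > 4). There exists p₀ = p₀(d,α) ∈ (1, 10/9] such that for every p ∈ (1, p₀) there is a constant C = C(d,α,p) with the following property: for every Borel measurable g : ℝ^d × ℝ^d → [0,∞) with g(x,y) ≤ |x−y|^{−α} ∧ 1 for all x,y, one has ∫_{ℝ^d} ∫_{ℝ^d} I_t(x) · I_t(y) · g(x,y) dx dy ≤ C for all t ≥ 1. -/
open MeasureTheory ProbabilityTheory Set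
open scoped ENNReal NNReal

noncomputable section

/-- Gaussian heat kernel on `ℝ^d` at time `t`, evaluated at displacement `z`:
`p_t(x,y) = gaussKer d t (y - x)`. -/
noncomputable def gaussKer (d : ℕ) (t : ℝ) (z : EuclideanSpace ℝ (Fin d)) : ℝ :=
  (2 * Real.pi * t) ^ (-(d : ℝ) / 2) * Real.exp (-‖z‖ ^ 2 / (2 * t))

/-- `I_t(x) = min{1, ∫₀ᵗ s^(d/2 − d/(2p)) p_(8s)(x) ds}`. -/
noncomputable def Ifun (d : ℕ) (p : ℝ) (t : ℝ) (x : EuclideanSpace ℝ (Fin d)) : ℝ :=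
  min 1 (∫ s in Ioc (0 : ℝ) t, s ^ ((d : ℝ) / 2 - (d : ℝ) / (2 * p)) * gaussKer d (8 * s) x)

lemma Ifun_nonneg (d : ℕ) (p t : ℝ) (x : EuclideanSpace ℝ (Fin d)) : 0 ≤ Ifun d p t x := by
  refine le_min zero_le_one (setIntegral_nonneg measurableSet_Ioc fun s hs => ?_)
  have hs0 : 0 < s := hs.1
  unfold gaussKer
  positivity

/-- A quantity bounded by `1` and by `C r ^ (-m)` for `r ≥ 1` is at most a multiple of
`(1 + r) ^ (-m)`. -/
lemma le_mul_one_add_rpow_neg {r m v C : ℝ} (hr : 0 ≤ r) (hm : 0 ≤ m) (hC : 1 ≤ C)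
    (hv : v ≤ 1) (hv' : 1 ≤ r → v ≤ C * r ^ (-m)) :
    v ≤ C * 2 ^ m * (1 + r) ^ (-m) := by
  have key : ∀ s : ℝ, 0 < s → 1 + r ≤ 2 * s → s ^ (-m) ≤ 2 ^ m * (1 + r) ^ (-m) := by
    intro s hs h
    calc s ^ (-m) = 2 ^ m * (2 * s) ^ (-m) := by
          rw [Real.mul_rpow zero_le_two hs.le, ← mul_assoc, ← Real.rpow_add zero_lt_two]
          simp
      _ ≤ 2 ^ m * (1 + r) ^ (-m) := by
          exact mul_le_mul_of_nonneg_left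
            (Real.rpow_le_rpow_of_nonpos (by linarith) h (by linarith)) (by positivity)
  rw [mul_assoc]
  rcases le_total 1 r with h | h
  · exact (hv' h).trans (by gcongr; exact key r (by linarith) (by linarith))
  · have := key 1 one_pos (by linarith)
    rw [Real.one_rpow] at this
    nlinarith

lemma integrableOn_rpow_neg_mul_exp_neg_div {b c : ℝ} (hb : 1 < b) (hc : 0 < c) :
    IntegrableOn (fun v : ℝ => v ^ (-b) * Real.exp (-c / v)) (Ioi 0) := by
  have h := integrableOn_rpow_mul_exp_neg_mul_rpow (p := 1) (s := b - 2) (by linarith) one_pos hc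
  rw [← integrableOn_Ioi_comp_rpow_iff' _ (p := -1) (by norm_num)] at h
  refine h.congr_fun (fun v hv => ?_) measurableSet_Ioi
  have hv : 0 < v := hv
  simp only [smul_eq_mul, Real.rpow_one]
  rw [← Real.rpow_mul hv.le, ← mul_assoc, ← Real.rpow_add hv, Real.rpow_neg_one, div_eq_mul_inv]
  congr 2
  ring

lemma rpow_neg_mul_exp_neg_div_comp_mul {b c R s : ℝ} (hR : 0 < R) (hs : 0 < s) :
    s ^ (-b) * Real.exp (-(R * c) / s) =
      R ^ (-b) * ((R⁻¹ * s) ^ (-b) * Real.exp (-c / (R⁻¹ * s))) := by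
  rw [← mul_assoc, ← Real.mul_rpow hR.le (by positivity), mul_inv_cancel_left₀ hR.ne']
  congr 2
  field_simp

lemma setIntegral_rpow_neg_mul_exp_neg_div_le {b c R : ℝ} (hb : 1 < b) (hc : 0 < c) (hR : 0 < R)
    (t : ℝ) :
    ∫ s in Ioc (0 : ℝ) t, s ^ (-b) * Real.exp (-(R * c) / s) ≤
      R ^ (1 - b) * ∫ v in Ioi (0 : ℝ), v ^ (-b) * Real.exp (-c / v) := by
  calc ∫ s in Ioc (0 : ℝ) t, s ^ (-b) * Real.exp (-(R * c) / s)
      ≤ ∫ s in Ioi (0 : ℝ), s ^ (-b) * Real.exp (-(R * c) / s) := by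
        refine setIntegral_mono_set (integrableOn_rpow_neg_mul_exp_neg_div hb (by positivity)) ?_
          Ioc_subset_Ioi_self.eventuallyLE
        refine (ae_restrict_mem measurableSet_Ioi).mono fun s hs => ?_
        have hs : 0 < s := hs
        simp only [Pi.zero_apply]
        positivity
    _ = ∫ s in Ioi (0 : ℝ), R ^ (-b) * ((R⁻¹ * s) ^ (-b) * Real.exp (-c / (R⁻¹ * s))) :=
        setIntegral_congr_fun measurableSet_Ioi fun s hs =>
          rpow_neg_mul_exp_neg_div_comp_mul hR hs
    _ = R ^ (1 - b) * ∫ v in Ioi (0 : ℝ), v ^ (-b) * Real.exp (-c / v) := by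
        rw [integral_const_mul,
          integral_comp_mul_left_Ioi (fun v => v ^ (-b) * Real.exp (-c / v)) 0 (inv_pos.2 hR),
          mul_zero, inv_inv, smul_eq_mul, ← mul_assoc, ← Real.rpow_add_one hR.ne']
        congr 2
        ring

/-- Uniform polynomial decay of `I_t`. -/
lemma exists_Ifun_le (d : ℕ) {p : ℝ} (hp : 0 < p) (hβ : 0 < (d : ℝ) / p - 2) :
    ∃ K : ℝ, 0 ≤ K ∧ ∀ t x, Ifun d p t x ≤ K * (1 + ‖x‖) ^ (-((d : ℝ) / p - 2)) := by
  set b : ℝ := d / (2 * p) with hb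
  have hb' : (d : ℝ) / p - 2 = 2 * (b - 1) := by rw [hb]; field_simp
  set J : ℝ := ∫ v in Ioi (0 : ℝ), v ^ (-b) * Real.exp (-(1 / 16) / v)
  set c : ℝ := (16 * Real.pi) ^ (-(d : ℝ) / 2)
  refine ⟨max 1 (c * J) * 2 ^ ((d : ℝ) / p - 2), by positivity, fun t x => ?_⟩
  refine le_mul_one_add_rpow_neg (norm_nonneg x) hβ.le (le_max_left _ _) (min_le_left _ _) ?_
  intro hx
  have hx0 : 0 < ‖x‖ := by linarith
  have hint : ∫ s in Ioc (0 : ℝ) t, s ^ ((d : ℝ) / 2 - (d : ℝ) / (2 * p)) * gaussKer d (8 * s) x =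
      c * ∫ s in Ioc (0 : ℝ) t, s ^ (-b) * Real.exp (-(‖x‖ ^ 2 * (1 / 16)) / s) := by
    rw [← integral_const_mul]
    refine setIntegral_congr_fun measurableSet_Ioc fun s hs => ?_
    have hs0 : 0 < s := hs.1
    have h1 : (2 * Real.pi * (8 * s)) ^ (-(d : ℝ) / 2) = c * s ^ (-(d : ℝ) / 2) := by
      rw [← Real.mul_rpow (by positivity) hs0.le]
      congr 1
      ring
    have h2 : s ^ (-b) = s ^ ((d : ℝ) / 2 - (d : ℝ) / (2 * p)) * s ^ (-(d : ℝ) / 2) := by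
      rw [← Real.rpow_add hs0]
      congr 1
      rw [hb]
      ring
    have h3 : -(‖x‖ ^ 2 * (1 / 16)) / s = -‖x‖ ^ 2 / (2 * (8 * s)) := by
      field_simp
      norm_num
    simp only [gaussKer]
    rw [h1, h2, h3]
    ring
  calc Ifun d p t x ≤ c * ∫ s in Ioc (0 : ℝ) t, s ^ (-b) * Real.exp (-(‖x‖ ^ 2 * (1 / 16)) / s) :=
        (min_le_right _ _).trans_eq hint
    _ ≤ c * ((‖x‖ ^ 2) ^ (1 - b) * J) := by
        gcongr
        exact setIntegral_rpow_neg_mul_exp_neg_div_le (by linarith) (by norm_num)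
          (by positivity) t
    _ = c * J * ‖x‖ ^ (-((d : ℝ) / p - 2)) := by
        rw [← Real.rpow_natCast, ← Real.rpow_mul hx0.le, hb']
        push_cast
        rw [show (2 : ℝ) * (1 - b) = -(2 * (b - 1)) by ring]
        ring
    _ ≤ max 1 (c * J) * ‖x‖ ^ (-((d : ℝ) / p - 2)) := by
        gcongr
        exact le_max_right _ _

/-- A weighted arithmetic-geometric mean inequality splitting a product of three powers into
sums of pairwise products. -/
lemma rpow_neg_mul_mul_le_pairwise {U V W a β α l : ℝ} (hU : 1 ≤ U) (hV : 1 ≤ V) (hW : 1 ≤ W)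
    (ha : 0 ≤ a) (ha1 : a ≤ 1) (hβ : l * (1 - a / 2) ≤ β) (hα : l * a ≤ α) :
    U ^ (-β) * V ^ (-β) * W ^ (-α) ≤
      U ^ (-l) * V ^ (-l) + U ^ (-l) * W ^ (-l) + V ^ (-l) * W ^ (-l) := by
  have hU0 : 0 < U := by linarith
  have hV0 : 0 < V := by linarith
  have hW0 : 0 < W := by linarith
  have hsplit : U ^ (-(l * (1 - a / 2))) * V ^ (-(l * (1 - a / 2))) * W ^ (-(l * a)) =
      (U ^ (-l) * V ^ (-l)) ^ (1 - a) * (U ^ (-l) * W ^ (-l)) ^ (a / 2) *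
        (V ^ (-l) * W ^ (-l)) ^ (a / 2) := by
    have e : ∀ X : ℝ, 0 < X → ∀ u v : ℝ, X ^ (-(l * (u + v))) = (X ^ (-l)) ^ u * (X ^ (-l)) ^ v := by
      intro X hX u v
      rw [← Real.rpow_add (by positivity), ← Real.rpow_mul hX.le]
      congr 1
      ring
    rw [Real.mul_rpow (by positivity) (by positivity), Real.mul_rpow (by positivity) (by positivity),
      Real.mul_rpow (by positivity) (by positivity), show 1 - a / 2 = (1 - a) + a / 2 by ring,
      e U hU0, e V hV0]
    have hWa := e W hW0 (a / 2) (a / 2)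
    rw [add_halves] at hWa
    rw [hWa]
    ring
  calc U ^ (-β) * V ^ (-β) * W ^ (-α)
      ≤ U ^ (-(l * (1 - a / 2))) * V ^ (-(l * (1 - a / 2))) * W ^ (-(l * a)) := by gcongr
    _ ≤ (1 - a) * (U ^ (-l) * V ^ (-l)) + a / 2 * (U ^ (-l) * W ^ (-l)) +
        a / 2 * (V ^ (-l) * W ^ (-l)) := by
        rw [hsplit]
        exact Real.geom_mean_le_arith_mean3_weighted (by linarith) (by linarith) (by linarith)
          (by positivity) (by positivity) (by positivity) (by ring)
    _ ≤ 1 * (U ^ (-l) * V ^ (-l)) + 1 * (U ^ (-l) * W ^ (-l)) + 1 * (V ^ (-l) * W ^ (-l)) := by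
        gcongr <;> linarith
    _ = _ := by ring

lemma lintegral_lintegral_pairwise_eq {E : Type*} [AddCommGroup E] [MeasurableSpace E]
    [MeasurableAdd₂ E] [MeasurableNeg E] (μ : Measure E) [SFinite μ] [μ.IsAddLeftInvariant]
    [μ.IsAddRightInvariant] [μ.IsNegInvariant] {F : E → ℝ≥0∞} (hF : Measurable F) :
    ∫⁻ x, ∫⁻ y, F x * F y + F x * F (x - y) + F y * F (x - y) ∂μ ∂μ = 3 * (∫⁻ x, F x ∂μ) ^ 2 := by
  have : MeasurableSub₂ E := ⟨by simp_rw [sub_eq_add_neg]; fun_prop⟩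
  have h3 : ∫⁻ x, ∫⁻ y, F y * F (x - y) ∂μ ∂μ = (∫⁻ x, F x ∂μ) * ∫⁻ x, F x ∂μ := by
    rw [lintegral_lintegral_swap (by fun_prop)]
    have h (y : E) : ∫⁻ x, F y * F (x - y) ∂μ = F y * ∫⁻ x, F x ∂μ := by
      rw [lintegral_const_mul _ (by fun_prop), lintegral_sub_right_eq_self F]
    simp_rw [h]
    rw [lintegral_mul_const _ hF]
  have h12 : ∀ x, ∫⁻ y, F x * F y + F x * F (x - y) + F y * F (x - y) ∂μ =
      F x * (∫⁻ y, F y ∂μ) + F x * (∫⁻ y, F y ∂μ) + ∫⁻ y, F y * F (x - y) ∂μ := by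
    intro x
    rw [lintegral_add_left (by fun_prop), lintegral_add_left (by fun_prop),
      lintegral_const_mul _ hF, lintegral_const_mul _ (by fun_prop),
      lintegral_sub_left_eq_self F x]
  simp_rw [h12]
  rw [lintegral_add_left (by fun_prop), lintegral_add_left (by fun_prop), h3,
    lintegral_mul_const _ hF]
  ring

/-- for d ≥ 5 and α > 4, there is p₀ ∈ (1,10/9] such that for every
p ∈ (1,p₀) there is C = C(d,α,p) with ∫∫ I_t(x) I_t(y) g(x,y) dx dy ≤ C for all
t ≥ 1, for every Borel g ≥ 0 with g(x,y) ≤ |x−y|^(−α) ∧ 1 (0^(−α) = ∞ in ℝ≥0∞). -/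
theorem double_integral_Ifun_g_bounded (d : ℕ) (hd : 5 ≤ d) (α : ℝ) (hα : 4 < α) :
    ∃ p₀ : ℝ, 1 < p₀ ∧ p₀ ≤ 10 / 9 ∧ ∀ p : ℝ, 1 < p → p < p₀ →
      ∃ C : ℝ, ∀ g : EuclideanSpace ℝ (Fin d) → EuclideanSpace ℝ (Fin d) → ℝ,
        Measurable (Function.uncurry g) → (∀ x y, 0 ≤ g x y) →
        (∀ x y, ENNReal.ofReal (g x y) ≤ min ((‖x - y‖₊ : ℝ≥0∞) ^ (-α)) 1) →
        ∀ t : ℝ, 1 ≤ t →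
          (∫⁻ x : EuclideanSpace ℝ (Fin d), ∫⁻ y : EuclideanSpace ℝ (Fin d),
            ENNReal.ofReal (Ifun d p t x * Ifun d p t y * g x y)) ≤
          ENNReal.ofReal C := by
  have hd5 : (5 : ℝ) ≤ d := by exact_mod_cast hd
  have hd0 : (0 : ℝ) < d := by linarith
  obtain ⟨a, ha4, ha⟩ : ∃ a : ℝ, 4 / d < a ∧ a < min 1 (α / d) :=
    exists_between (lt_min (by rw [div_lt_one hd0]; linarith) (by gcongr))
  obtain ⟨ha1, haα⟩ := lt_min_iff.1 ha
  have ha0 : 0 < a := lt_trans (by positivity) ha4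
  rw [div_lt_iff₀ hd0] at ha4
  rw [lt_div_iff₀ hd0] at haα
  have hq : 0 < d * (1 - a / 2) + 2 := by
    have := mul_pos hd0 (show 0 < 1 - a / 2 by linarith)
    linarith
  refine ⟨min (10 / 9) (d / (d * (1 - a / 2) + 2)), lt_min (by norm_num) ?_, min_le_left _ _, ?_⟩
  · rw [one_lt_div hq]
    linarith
  intro p hp1 hp
  obtain ⟨hp9, hpq⟩ := lt_min_iff.1 hp
  have hp0 : 0 < p := by linarith
  have hβd : d * (1 - a / 2) < d / p - 2 := by
    rw [lt_div_iff₀ hq] at hpq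
    rw [lt_sub_iff_add_lt, lt_div_iff₀ hp0]
    linarith
  have hβ : 0 < (d : ℝ) / p - 2 := lt_trans (mul_pos hd0 (by linarith)) hβd
  set β : ℝ := d / p - 2
  obtain ⟨l, hdl, hl⟩ : ∃ l : ℝ, d < l ∧ l < min (β / (1 - a / 2)) (α / a) :=
    exists_between (lt_min ((lt_div_iff₀ (by linarith)).2 hβd)
      ((lt_div_iff₀ ha0).2 (by linarith)))
  obtain ⟨hlβ, hlα⟩ := lt_min_iff.1 hl
  rw [lt_div_iff₀ (by linarith)] at hlβ
  rw [lt_div_iff₀ ha0] at hlα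
  obtain ⟨K, hK, hI⟩ := exists_Ifun_le d hp0 hβ
  let F : EuclideanSpace ℝ (Fin d) → ℝ≥0∞ := fun x => ENNReal.ofReal ((1 + ‖x‖) ^ (-l))
  have hF : Measurable F := by fun_prop
  have hJ : ∫⁻ x, F x < ∞ := finite_integral_one_add_norm (by simpa using hdl)
  refine ⟨(ENNReal.ofReal (K * K * 2 ^ α) * (3 * (∫⁻ x, F x) ^ 2)).toReal, ?_⟩
  intro g _ hg0 hg t _
  rw [ENNReal.ofReal_toReal (by finiteness), ← lintegral_lintegral_pairwise_eq volume hF]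
  have hgle : ∀ x y, g x y ≤ 2 ^ α * (1 + ‖x - y‖) ^ (-α) := by
    intro x y
    obtain ⟨h1, h2⟩ := le_min_iff.1 (hg x y)
    rw [← one_mul ((2 : ℝ) ^ α)]
    refine le_mul_one_add_rpow_neg (norm_nonneg _) (by linarith) le_rfl
      (ENNReal.ofReal_le_one.1 h2) fun hr => ?_
    rw [← enorm_eq_nnnorm, ← ofReal_norm, ENNReal.ofReal_rpow_of_pos (by linarith),
      ENNReal.ofReal_le_ofReal_iff (by positivity)] at h1
    rwa [one_mul]
  have hpt : ∀ x y, ENNReal.ofReal (Ifun d p t x * Ifun d p t y * g x y) ≤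
      ENNReal.ofReal (K * K * 2 ^ α) *
        (F x * F y + F x * F (x - y) + F y * F (x - y)) := by
    intro x y
    simp only [F]
    rw [← ENNReal.ofReal_mul (by positivity), ← ENNReal.ofReal_mul (by positivity),
      ← ENNReal.ofReal_mul (by positivity), ← ENNReal.ofReal_add (by positivity) (by positivity),
      ← ENNReal.ofReal_add (by positivity) (by positivity), ← ENNReal.ofReal_mul (by positivity)]
    refine ENNReal.ofReal_le_ofReal ?_
    calc Ifun d p t x * Ifun d p t y * g x y
        ≤ (K * (1 + ‖x‖) ^ (-β)) * (K * (1 + ‖y‖) ^ (-β)) *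
            (2 ^ α * (1 + ‖x - y‖) ^ (-α)) := by
          gcongr
          · exact hg0 x y
          · exact Ifun_nonneg d p t y
          · exact hI t x
          · exact hI t y
          · exact hgle x y
      _ = K * K * 2 ^ α *
            ((1 + ‖x‖) ^ (-β) * (1 + ‖y‖) ^ (-β) * (1 + ‖x - y‖) ^ (-α)) := by ring
      _ ≤ _ := by
          gcongr
          exact rpow_neg_mul_mul_le_pairwise (by simp) (by simp) (by simp) ha0.le ha1.le
            hlβ.le hlα.le
  calc _ ≤ ∫⁻ x, ∫⁻ y, ENNReal.ofReal (K * K * 2 ^ α) *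
        (F x * F y + F x * F (x - y) + F y * F (x - y)) := by
        gcongr with x y
        exact hpt x y
    _ = _ := by
        simp_rw [lintegral_const_mul' _ _ ENNReal.ofReal_ne_top]
end
end

section
/- Let d ≥ 1. Let α, F, G : [0,∞) × ℝ^d → ℝ be continuous functions such that for all t ≥ 0 and x ∈ ℝ^d: G(t,x) ≤ α(t,x) + ∫₀^t ∫_{ℝ^d} p_{t−s}(x,y) G(s,y) dy ds and F(t,x) = α(t,x) + ∫₀^t ∫_{ℝ^d} p_{t−s}(x,y) F(s,y) dy ds, where all the integrals are well defined and finite. Assume in addition that h_t := ∫_{ℝ^d} max(G(t,x) − F(t,x), 0) dx is finite for every t ≥ 0 and that t ↦ h_t is measurable and locally bounded on [0,∞). Then G(t,x) ≤ F(t,x) for all t ≥ 0 and x ∈ ℝ^d. -/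
open MeasureTheory Set
open scoped ENNReal NNReal

noncomputable section

/-- The Gaussian heat kernel is nonnegative at nonnegative times. -/
lemma gaussKer_nonneg (d : ℕ) {r : ℝ} (hr : 0 ≤ r) (z : EuclideanSpace ℝ (Fin d)) :
    0 ≤ gaussKer d r z := by
  unfold gaussKer; positivity

/-- The Gaussian heat kernel is jointly measurable in time and space. -/
lemma measurable_gaussKer (d : ℕ) :
    Measurable fun q : ℝ × EuclideanSpace ℝ (Fin d) => gaussKer d q.1 q.2 := by
  unfold gaussKer; fun_prop

/-- The Gaussian heat kernel has unit mass at positive times. -/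
lemma integral_gaussKer (d : ℕ) {r : ℝ} (hr : 0 < r) : ∫ z, gaussKer d r z = 1 := by
  have h := GaussianFourier.integral_rexp_neg_mul_sq_norm
    (V := EuclideanSpace ℝ (Fin d)) (b := 1 / (2 * r)) (by positivity)
  have e : ∀ z : EuclideanSpace ℝ (Fin d),
      Real.exp (-‖z‖ ^ 2 / (2 * r)) = Real.exp (-(1 / (2 * r)) * ‖z‖ ^ 2) := by
    intro z; congr 1; ring
  have hb : Real.pi / (1 / (2 * r)) = 2 * Real.pi * r := by field_simp
  simp only [gaussKer, e, integral_const_mul]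
  rw [h, hb, finrank_euclideanSpace_fin, ← Real.rpow_add (by positivity)]
  simp [neg_div]

/-- The Gaussian heat kernel has mass at most one at nonnegative times. -/
lemma lintegral_gaussKer_le_one {d : ℕ} (hd : 1 ≤ d) {r : ℝ} (hr : 0 ≤ r) :
    ∫⁻ z, ENNReal.ofReal (gaussKer d r z) ≤ 1 := by
  rcases hr.eq_or_lt with rfl | hr
  · have hne : -(d : ℝ) / 2 ≠ 0 := by
      have : (1 : ℝ) ≤ d := by exact_mod_cast hd
      intro h0
      linarith
    simp [gaussKer, Real.zero_rpow hne]
  · have h := integral_gaussKer d hr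
    rw [← ofReal_integral_eq_lintegral_ofReal
      (integrable_of_integral_eq_one h) (.of_forall (gaussKer_nonneg d hr.le)), h]
    simp

/-- The positive part of a Bochner integral is at most the integral of the positive part. -/
lemma ofReal_integral_le_lintegral_ofReal {X : Type*} [MeasurableSpace X] {μ : Measure X}
    {f : X → ℝ} (hf : Integrable f μ) :
    ENNReal.ofReal (∫ x, f x ∂μ) ≤ ∫⁻ x, ENNReal.ofReal (f x) ∂μ := by
  refine ENNReal.ofReal_le_of_le_toReal ?_
  rw [integral_eq_lintegral_pos_part_sub_lintegral_neg_part hf]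
  exact sub_le_self _ ENNReal.toReal_nonneg

lemma lintegral_Ioc_pow_div_factorial (n : ℕ) {t : ℝ} (ht : 0 ≤ t) :
    ∫⁻ s in Ioc 0 t, ENNReal.ofReal (s ^ n / n.factorial) =
      ENNReal.ofReal (t ^ (n + 1) / (n + 1).factorial) := by
  have hi : IntegrableOn (fun s : ℝ => s ^ n / n.factorial) (Ioc 0 t) :=
    ((by fun_prop : Continuous fun s : ℝ => s ^ n / n.factorial).integrableOn_Icc).mono_set
      Ioc_subset_Icc_self
  rw [← ofReal_integral_eq_lintegral_ofReal hi, ← intervalIntegral.integral_of_le ht,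
    intervalIntegral.integral_div, integral_pow, Nat.factorial_succ]
  · push_cast
    congr 1
    field_simp
    simp
  · filter_upwards [ae_restrict_mem measurableSet_Ioc] with s hs
    have := hs.1.le
    simp only [Pi.zero_apply]
    positivity

/-- Gronwall's inequality for bounded extended nonnegative functions with zero forcing. -/
lemma eq_zero_of_le_lintegral_Ioc {H : ℝ → ℝ≥0∞} {T : ℝ} {M : ℝ≥0∞} (hM : M ≠ ∞)
    (hb : ∀ t ∈ Icc 0 T, H t ≤ M)
    (hH : ∀ t ∈ Icc 0 T, H t ≤ ∫⁻ s in Ioc 0 t, H s) {t : ℝ} (ht : t ∈ Icc 0 T) :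
    H t = 0 := by
  have key : ∀ n : ℕ, ∀ t ∈ Icc 0 T, H t ≤ M * ENNReal.ofReal (t ^ n / n.factorial) := by
    intro n
    induction n with
    | zero => simpa using hb
    | succ n ih =>
      intro t ht
      calc H t ≤ ∫⁻ s in Ioc 0 t, H s := hH t ht
        _ ≤ ∫⁻ s in Ioc 0 t, M * ENNReal.ofReal (s ^ n / n.factorial) :=
          setLIntegral_mono' measurableSet_Ioc fun s hs => ih s ⟨hs.1.le, hs.2.trans ht.2⟩
        _ = _ := by rw [lintegral_const_mul' _ _ hM, lintegral_Ioc_pow_div_factorial n ht.1]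
  have hlim : Filter.Tendsto (fun n : ℕ => M * ENNReal.ofReal (t ^ n / n.factorial))
      Filter.atTop (nhds (M * ENNReal.ofReal 0)) :=
    ENNReal.Tendsto.const_mul
      (ENNReal.tendsto_ofReal (FloorSemiring.tendsto_pow_div_factorial_atTop t)) (.inr hM)
  simp only [ENNReal.ofReal_zero, mul_zero] at hlim
  exact le_antisymm (ge_of_tendsto' hlim fun n => key n t ht) zero_le

/-- Smoothing a measurable function in space by the heat kernel does not increase its mass. -/
lemma lintegral_heat_le {d : ℕ} (hd : 1 ≤ d) {u : ℝ × EuclideanSpace ℝ (Fin d) → ℝ≥0∞}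
    (hu : Measurable u) (t : ℝ) :
    ∫⁻ x, ∫⁻ s in Ioc 0 t, ∫⁻ y, ENNReal.ofReal (gaussKer d (t - s) (y - x)) * u (s, y) ≤
      ∫⁻ s in Ioc 0 t, ∫⁻ y, u (s, y) := by
  have hk := measurable_gaussKer d
  have hm : Measurable fun q : (EuclideanSpace ℝ (Fin d) × ℝ) × EuclideanSpace ℝ (Fin d) =>
      ENNReal.ofReal (gaussKer d (t - q.1.2) (q.2 - q.1.1)) * u (q.1.2, q.2) := by
    refine Measurable.mul (ENNReal.measurable_ofReal.comp ?_) (by fun_prop)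
    exact hk.comp (by fun_prop :
      Measurable fun q : (EuclideanSpace ℝ (Fin d) × ℝ) × EuclideanSpace ℝ (Fin d) =>
        (t - q.1.2, q.2 - q.1.1))
  rw [lintegral_lintegral_swap hm.lintegral_prod_right'.aemeasurable]
  refine setLIntegral_mono' measurableSet_Ioc fun s hs => ?_
  rw [lintegral_lintegral_swap]
  · refine lintegral_mono fun y => ?_
    have hky : Measurable fun x => ENNReal.ofReal (gaussKer d (t - s) (y - x)) :=
      ENNReal.measurable_ofReal.comp (hk.comp (by fun_prop :
        Measurable fun x : EuclideanSpace ℝ (Fin d) => (t - s, y - x)))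
    rw [lintegral_mul_const _ hky,
      lintegral_sub_left_eq_self (fun z => ENNReal.ofReal (gaussKer d (t - s) z)) y]
    exact mul_le_of_le_one_left' (lintegral_gaussKer_le_one hd (sub_nonneg.2 hs.2))
  · exact (hm.comp (by fun_prop :
      Measurable fun q : EuclideanSpace ℝ (Fin d) × EuclideanSpace ℝ (Fin d) =>
        ((q.1, s), q.2))).aemeasurable

/-- generalized Gronwall inequality for the heat kernel. -/
theorem heat_kernel_gronwall (d : ℕ) (hd : 1 ≤ d)
    (a F G : ℝ → EuclideanSpace ℝ (Fin d) → ℝ)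
    (ha : ContinuousOn (fun q : ℝ × EuclideanSpace ℝ (Fin d) => a q.1 q.2)
      (Ici (0 : ℝ) ×ˢ univ))
    (hFc : ContinuousOn (fun q : ℝ × EuclideanSpace ℝ (Fin d) => F q.1 q.2)
      (Ici (0 : ℝ) ×ˢ univ))
    (hGc : ContinuousOn (fun q : ℝ × EuclideanSpace ℝ (Fin d) => G q.1 q.2)
      (Ici (0 : ℝ) ×ˢ univ))
    -- all the integrals appearing below are well defined and finite:
    (hGint : ∀ t : ℝ, 0 ≤ t → ∀ x : EuclideanSpace ℝ (Fin d),
      Integrable (fun q : ℝ × EuclideanSpace ℝ (Fin d) =>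
          gaussKer d (t - q.1) (q.2 - x) * G q.1 q.2)
        ((volume.restrict (Ioc (0 : ℝ) t)).prod volume))
    (hFint : ∀ t : ℝ, 0 ≤ t → ∀ x : EuclideanSpace ℝ (Fin d),
      Integrable (fun q : ℝ × EuclideanSpace ℝ (Fin d) =>
          gaussKer d (t - q.1) (q.2 - x) * F q.1 q.2)
        ((volume.restrict (Ioc (0 : ℝ) t)).prod volume))
    (hG : ∀ t : ℝ, 0 ≤ t → ∀ x : EuclideanSpace ℝ (Fin d),
      G t x ≤ a t x + ∫ s in Ioc (0 : ℝ) t, ∫ y, gaussKer d (t - s) (y - x) * G s y)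
    (hF : ∀ t : ℝ, 0 ≤ t → ∀ x : EuclideanSpace ℝ (Fin d),
      F t x = a t x + ∫ s in Ioc (0 : ℝ) t, ∫ y, gaussKer d (t - s) (y - x) * F s y)
    -- h_t := ∫ max(G − F, 0) dx is finite for every t ≥ 0,
    (hhInt : ∀ t : ℝ, 0 ≤ t →
      Integrable (fun x : EuclideanSpace ℝ (Fin d) => max (G t x - F t x) 0))
    -- measurable in t,
    (hhMeas : Measurable fun t : ℝ =>
      ∫ x : EuclideanSpace ℝ (Fin d), max (G t x - F t x) 0)
    -- and locally bounded on [0,∞):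
    (hhBdd : ∀ T : ℝ, 0 ≤ T → ∃ M : ℝ, ∀ t ∈ Icc (0 : ℝ) T,
      (∫ x : EuclideanSpace ℝ (Fin d), max (G t x - F t x) 0) ≤ M) :
    ∀ t : ℝ, 0 ≤ t → ∀ x : EuclideanSpace ℝ (Fin d), G t x ≤ F t x := by
  set u : ℝ × EuclideanSpace ℝ (Fin d) → ℝ≥0∞ :=
    (Ici (0 : ℝ) ×ˢ univ).indicator fun q => ENNReal.ofReal (G q.1 q.2 - F q.1 q.2) with hu_def
  have hS : MeasurableSet (Ici (0 : ℝ) ×ˢ (univ : Set (EuclideanSpace ℝ (Fin d)))) :=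
    measurableSet_Ici.prod .univ
  have hu : Measurable u := by
    have hc := ENNReal.continuous_ofReal.comp_continuousOn (hGc.sub hFc)
    classical
    rw [hu_def, ← piecewise_eq_indicator]
    exact hc.measurable_piecewise continuousOn_const hS
  have hu_apply : ∀ {t : ℝ}, 0 ≤ t → ∀ x, u (t, x) = ENNReal.ofReal (G t x - F t x) := by
    intro t ht x
    exact indicator_of_mem (by simpa using ht) _
  have hpt : ∀ t : ℝ, 0 ≤ t → ∀ x, u (t, x) ≤
      ∫⁻ s in Ioc 0 t, ∫⁻ y, ENNReal.ofReal (gaussKer d (t - s) (y - x)) * u (s, y) := by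
    intro t ht x
    have hsub := (hGint t ht x).sub (hFint t ht x)
    have hle : G t x - F t x ≤ ∫ q, (gaussKer d (t - q.1) (q.2 - x) * G q.1 q.2 -
        gaussKer d (t - q.1) (q.2 - x) * F q.1 q.2)
        ∂((volume.restrict (Ioc (0 : ℝ) t)).prod volume) := by
      rw [integral_sub (hGint t ht x) (hFint t ht x), integral_prod _ (hGint t ht x),
        integral_prod _ (hFint t ht x)]
      linarith [hG t ht x, hF t ht x]
    rw [hu_apply ht]
    refine (ENNReal.ofReal_le_ofReal hle).trans
      ((ofReal_integral_le_lintegral_ofReal hsub).trans ?_)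
    rw [lintegral_prod _ hsub.aestronglyMeasurable.aemeasurable.ennreal_ofReal]
    refine setLIntegral_mono' measurableSet_Ioc fun s hs => lintegral_mono fun y => ?_
    rw [hu_apply hs.1.le, ← ENNReal.ofReal_mul (gaussKer_nonneg d (sub_nonneg.2 hs.2) _)]
    simp [mul_sub]
  have hzero : ∀ t : ℝ, 0 ≤ t → ∫⁻ x, u (t, x) = 0 := by
    intro T hT
    obtain ⟨M, hM⟩ := hhBdd T hT
    refine eq_zero_of_le_lintegral_Ioc (H := fun t => ∫⁻ x, u (t, x)) (T := T)
      (M := ENNReal.ofReal M) ENNReal.ofReal_ne_top (fun t ht => ?_) (fun t ht => ?_) ⟨hT, le_rfl⟩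
    · refine le_trans (le_of_eq ?_) (ENNReal.ofReal_le_ofReal (hM t ht))
      rw [ofReal_integral_eq_lintegral_ofReal (hhInt t ht.1)
        (.of_forall fun x => le_max_right _ _)]
      simp [hu_apply ht.1]
    · exact (lintegral_mono (hpt t ht.1)).trans (lintegral_heat_le hd hu t)
  intro t ht x
  have h0 : u (t, x) ≤ 0 := by
    refine (hpt t ht x).trans (le_of_eq ?_)
    refine setLIntegral_eq_zero measurableSet_Ioc fun s hs => ?_
    have hae := (lintegral_eq_zero_iff (by fun_prop)).1 (hzero s hs.1.le)
    refine lintegral_eq_zero_of_ae_eq_zero ?_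
    filter_upwards [hae] with y hy
    simp only [Pi.zero_apply] at hy ⊢
    rw [hy, mul_zero]
  rw [hu_apply ht, nonpos_iff_eq_zero, ENNReal.ofReal_eq_zero] at h0
  linarith
end
end
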